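/- Let d ≥ 3 and let G_H be the Green's function of the simple random walk on the half lattice H = {x ∈ ℤ^d : x₁ ≥ 0} without killing. Then inf_{x ∈ H} G_H(x, x) = g(0, 0), sup_{x ∈ H} G_H(x, x) = G_H(0, 0), and the inequality g(0,0) < G_H(0,0) is strict, where g is the Green's function of the simple random walk on ℤ^d. -/

import Mathlib

open scoped ENNReal
open Filter

noncomputable section

variable {V : Type*}

/-- Total conductance (weight) `π(x) = Σ_y c(x,y)` at a vertex `x`. -/
def piW (c : V → V → ℝ≥0∞) (x : V) : ℝ≥0∞ := ∑' y, c x y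

/-- One-step transition probability `c(x,y)/π(x)` of the random walk with conductances `c`. -/
def step (c : V → V → ℝ≥0∞) (x y : V) : ℝ≥0∞ := c x y / piW c x

/-- `n`-step transition probability of the random walk with conductances `c`. -/
def stepN [DecidableEq V] (c : V → V → ℝ≥0∞) : ℕ → V → V → ℝ≥0∞
  | 0, x, y => if x = y then 1 else 0
  | n + 1, x, y => ∑' z, stepN c n x z * step c z y

/-- Green's function `G(x,y) = π(y)⁻¹ Σ_n p_n(x,y)` of the walk with conductances `c`. -/
def green [DecidableEq V] (c : V → V → ℝ≥0∞) (x y : V) : ℝ≥0∞ :=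
  (piW c y)⁻¹ * ∑' n, stepN c n x y

/-- Nearest-neighbour adjacency on `ℤ^d`. -/
def latAdj {d : ℕ} (x y : Fin d → ℤ) : Prop := (∑ i, (x i - y i).natAbs) = 1

instance {d : ℕ} (x y : Fin d → ℤ) : Decidable (latAdj x y) := by
  unfold latAdj; infer_instance

/-- Unit conductances on `ℤ^d`. -/
def cZ (d : ℕ) (x y : Fin d → ℤ) : ℝ≥0∞ := if latAdj x y then 1 else 0

/-- Green's function of the simple random walk on `ℤ^d`. -/
def g (d : ℕ) : (Fin d → ℤ) → (Fin d → ℤ) → ℝ≥0∞ := green (cZ d)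

/-- Membership in `U_m = ℕ₀^m × ℤ^{d-m}`: the first `m` coordinates are nonnegative. -/
def memU (m : ℕ) {d : ℕ} (x : Fin d → ℤ) : Prop := ∀ i : Fin d, (i : ℕ) < m → 0 ≤ x i

instance (m : ℕ) {d : ℕ} (x : Fin d → ℤ) : Decidable (memU m x) := by
  unfold memU; infer_instance

/-- Unit conductances on the subgraph `U_m` of `ℤ^d`. -/
def cU (d m : ℕ) (x y : Fin d → ℤ) : ℝ≥0∞ :=
  if memU m x ∧ memU m y ∧ latAdj x y then 1 else 0

/-- Green's function `G_m` of the simple random walk on `U_m = ℕ₀^m × ℤ^{d-m}`. -/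
def Gm (d m : ℕ) : (Fin d → ℤ) → (Fin d → ℤ) → ℝ≥0∞ := green (cU d m)

/-- Reflection in the first coordinate: `ȳ = (-y₁, y₂, …, y_d)`. -/
def reflFirst {d : ℕ} (y : Fin d → ℤ) : Fin d → ℤ := fun i => if (i : ℕ) = 0 then -y i else y i

/-- The first standard basis vector of `ℤ^d`. -/
def e1 (d : ℕ) : Fin d → ℤ := fun i => if (i : ℕ) = 0 then 1 else 0


section Network

variable [DecidableEq V] (c : V → V → ℝ≥0∞)

theorem sum_sum_stepN_le {A : Finset V} {v : V → ℝ≥0∞}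
    (hv : ∀ y, (if y ∈ A then 1 else 0) + ∑' z, v z * step c z y ≤ v y) (N : ℕ) (y : V) :
    ∑ n ∈ Finset.range N, ∑ x ∈ A, stepN c n x y ≤ v y := by
  induction N generalizing y with
  | zero => simp
  | succ N ih =>
    rw [Finset.sum_range_succ', add_comm]
    refine le_trans (add_le_add ?_ ?_) (hv y)
    · simp [stepN]
    · calc ∑ n ∈ Finset.range N, ∑ x ∈ A, stepN c (n + 1) x y
          = ∑' z, (∑ n ∈ Finset.range N, ∑ x ∈ A, stepN c n x z) * step c z y := by
            simp only [stepN, Finset.sum_mul]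
            rw [Summable.tsum_finsetSum (fun _ _ => ENNReal.summable)]
            refine Finset.sum_congr rfl fun n _ => ?_
            rw [Summable.tsum_finsetSum (fun _ _ => ENNReal.summable)]
        _ ≤ _ := ENNReal.tsum_le_tsum fun z => by gcongr; exact ih z

/-- Minimality of the Green's function among supersolutions of the Poisson equation. -/
theorem sum_green_le {A : Finset V} {u : V → ℝ≥0∞}
    (hu : ∀ y, (if y ∈ A then 1 else 0) + ∑' z, u z * c z y ≤ piW c y * u y) (y : V) :
    ∑ x ∈ A, green c x y ≤ u y := by
  have hv : ∀ y, (if y ∈ A then 1 else 0) + ∑' z, (piW c z * u z) * step c z y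
      ≤ piW c y * u y := fun y => by
    refine le_trans (add_le_add le_rfl (ENNReal.tsum_le_tsum fun z => ?_)) (hu y)
    calc piW c z * u z * step c z y = (piW c z * (piW c z)⁻¹) * (u z * c z y) := by
          rw [step, div_eq_mul_inv]; ring
      _ ≤ 1 * (u z * c z y) := by gcongr; exact ENNReal.mul_inv_le_one _
      _ = _ := one_mul _
  have hsum : ∑' n, ∑ x ∈ A, stepN c n x y ≤ piW c y * u y := by
    rw [ENNReal.tsum_eq_iSup_nat]
    exact iSup_le fun N => sum_sum_stepN_le c hv N y
  calc ∑ x ∈ A, green c x y = (piW c y)⁻¹ * ∑' n, ∑ x ∈ A, stepN c n x y := by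
        rw [Summable.tsum_finsetSum (fun _ _ => ENNReal.summable), Finset.mul_sum]; rfl
    _ ≤ (piW c y)⁻¹ * (piW c y * u y) := by gcongr
    _ = (piW c y * (piW c y)⁻¹) * u y := by ring
    _ ≤ 1 * u y := by gcongr; exact ENNReal.mul_inv_le_one _
    _ = u y := one_mul _

/-- The Poisson equation for the Green's function. -/
theorem piW_mul_green (x : V) {y : V} (h0 : piW c y ≠ 0) (ht : piW c y ≠ ∞) :
    piW c y * green c x y = (if x = y then 1 else 0) + ∑' z, green c x z * c z y := by
  rw [green, ← mul_assoc, ENNReal.mul_inv_cancel h0 ht, one_mul,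
    tsum_eq_zero_add' ENNReal.summable]
  congr 1
  simp only [stepN]
  rw [ENNReal.tsum_comm]
  refine tsum_congr fun z => ?_
  rw [ENNReal.tsum_mul_right, step, green, div_eq_mul_inv]
  ring

omit [DecidableEq V] in
theorem piW_perm (φ : Equiv.Perm V) (hφ : ∀ x y, c (φ x) (φ y) = c x y) (x : V) :
    piW c (φ x) = piW c x := by
  unfold piW
  rw [← φ.tsum_eq]
  simp only [hφ]

theorem stepN_perm (φ : Equiv.Perm V) (hφ : ∀ x y, c (φ x) (φ y) = c x y) (n : ℕ) (x y : V) :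
    stepN c n (φ x) (φ y) = stepN c n x y := by
  induction n generalizing y with
  | zero => simp [stepN]
  | succ n ih =>
    simp only [stepN]
    rw [← φ.tsum_eq]
    refine tsum_congr fun z => ?_
    rw [ih, step, step, hφ, piW_perm c φ hφ]

theorem green_perm (φ : Equiv.Perm V) (hφ : ∀ x y, c (φ x) (φ y) = c x y) (x y : V) :
    green c (φ x) (φ y) = green c x y := by
  simp only [green, stepN_perm c φ hφ, piW_perm c φ hφ]

end Network

section Lattice

variable {d : ℕ}

theorem latAdj_comm {x y : Fin d → ℤ} : latAdj x y ↔ latAdj y x := by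
  unfold latAdj
  have h : ∀ i, (x i - y i).natAbs = (y i - x i).natAbs := fun i => by omega
  simp only [h]

theorem cZ_comm (x y : Fin d → ℤ) : cZ d x y = cZ d y x := by
  simp only [cZ, latAdj_comm (x := x)]

theorem cU_comm (m : ℕ) (x y : Fin d → ℤ) : cU d m x y = cU d m y x := by
  unfold cU
  congr 1
  rw [latAdj_comm (x := x)]
  exact propext ⟨fun h => ⟨h.2.1, h.1, h.2.2⟩, fun h => ⟨h.2.1, h.1, h.2.2⟩⟩

/-- The neighbour `y ± e_i` of `y`, the sign being `+` when `b` is true. -/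
def nbr (y : Fin d → ℤ) (p : Fin d × Bool) : Fin d → ℤ :=
  y + Pi.single p.1 (if p.2 then 1 else -1)

theorem nbr_injective (y : Fin d → ℤ) : Function.Injective (nbr y) := by
  rintro ⟨i, a⟩ ⟨j, b⟩ h
  have h1 := add_left_cancel h
  have hi := congrFun h1 i
  have hij : i = j := by
    by_contra hne
    rw [Pi.single_eq_same, Pi.single_eq_of_ne hne] at hi
    cases a <;> simp at hi
  subst hij
  rw [Pi.single_eq_same, Pi.single_eq_same] at hi
  cases a <;> cases b <;> simp_all

theorem latAdj_iff_mem_range_nbr {z y : Fin d → ℤ} : latAdj z y ↔ z ∈ Set.range (nbr y) := by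
  constructor
  · intro h
    unfold latAdj at h
    have hex : ∃ i, (z i - y i).natAbs ≠ 0 := by
      by_contra! hall
      simp [hall] at h
    obtain ⟨i, hi⟩ := hex
    rw [← Finset.add_sum_erase _ _ (Finset.mem_univ i)] at h
    have h0 : ∑ j ∈ Finset.univ.erase i, (z j - y j).natAbs = 0 := by omega
    have h1 : (z i - y i).natAbs = 1 := by omega
    rw [Finset.sum_eq_zero_iff] at h0
    refine ⟨(i, decide (z i - y i = 1)), ?_⟩
    funext j
    by_cases hj : j = i
    · subst hj
      simp only [nbr, Pi.add_apply, Pi.single_eq_same, decide_eq_true_eq]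
      split_ifs <;> omega
    · have := h0 j (by simp [hj])
      simp only [nbr, Pi.add_apply, Pi.single_eq_of_ne hj]
      omega
  · rintro ⟨⟨i, b⟩, rfl⟩
    unfold latAdj
    rw [Finset.sum_eq_single i]
    · cases b <;> simp [nbr]
    · intro j _ hj
      simp [nbr, hj]
    · simp

theorem tsum_mul_cZ (F : (Fin d → ℤ) → ℝ≥0∞) (y : Fin d → ℤ) :
    ∑' z, F z * cZ d z y = ∑ p, F (nbr y p) := by
  rw [← tsum_fintype (L := SummationFilter.unconditional _), ← tsum_range F (nbr_injective y),
    tsum_subtype (Set.range (nbr y)) F]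
  refine tsum_congr fun z => ?_
  by_cases h : latAdj z y
  · rw [Set.indicator_of_mem (latAdj_iff_mem_range_nbr.1 h), cZ, if_pos h, mul_one]
  · rw [Set.indicator_of_notMem (mt latAdj_iff_mem_range_nbr.2 h), cZ, if_neg h, mul_zero]

theorem tsum_cZ (y : Fin d → ℤ) : ∑' z, cZ d z y = 2 * d := by
  have := tsum_mul_cZ (fun _ => 1) y
  simp only [one_mul] at this
  rw [this]
  simp [mul_comm]

theorem piW_cZ (y : Fin d → ℤ) : piW (cZ d) y = 2 * d := by
  rw [← tsum_cZ y, piW]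
  simp only [cZ_comm y]

theorem piW_cZ_ne_top (y : Fin d → ℤ) : piW (cZ d) y ≠ ∞ := by
  rw [piW_cZ]
  finiteness

theorem piW_cZ_ne_zero [NeZero d] (y : Fin d → ℤ) : piW (cZ d) y ≠ 0 := by
  rw [piW_cZ]
  simp [NeZero.ne d]

end Lattice

section Superharmonic

theorem inv_sqrt_one_add_le {u : ℝ} (hu : u ^ 2 ≤ 1 / 12) :
    (√(1 + u))⁻¹ ≤ 1 - u / 2 + 3 / 8 * u ^ 2 - 5 / 16 * u ^ 3 + u ^ 4 := by
  have hl : -(1 / 3) ≤ u := by nlinarith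
  have hr : u ≤ 1 / 3 := by nlinarith
  have hq : 0 < 1 - u / 2 + 3 / 8 * u ^ 2 - 5 / 16 * u ^ 3 + u ^ 4 := by
    nlinarith [sq_nonneg u, sq_nonneg (u ^ 2),
      mul_nonneg (sq_nonneg u) (by linarith : 0 ≤ 1 / 3 - u)]
  rw [inv_le_comm₀ (Real.sqrt_pos.2 (by linarith)) hq]
  refine Real.le_sqrt_of_sq_le ?_
  rw [inv_pow, inv_le_iff_one_le_mul₀ (by positivity)]
  have hpoly : 0 ≤ 93 / 64 + 39 / 32 * u - 99 / 256 * u ^ 2 + 57 / 256 * u ^ 3 + 3 / 8 * u ^ 4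
      + u ^ 5 := by
    have h3 : 0 ≤ u ^ 2 * (u + 1 / 3) := mul_nonneg (sq_nonneg u) (by linarith)
    have h5 : 0 ≤ u ^ 4 * (u + 1 / 3) := mul_nonneg (by positivity) (by linarith)
    nlinarith [sq_nonneg (u ^ 2)]
  nlinarith [mul_nonneg (by positivity : 0 ≤ u ^ 4) hpoly]

theorem inv_sqrt_add_inv_sqrt_sub_le {u : ℝ} (hu : u ^ 2 ≤ 1 / 12) :
    (√(1 + u))⁻¹ + (√(1 - u))⁻¹ ≤ 2 + 3 / 4 * u ^ 2 + 2 * u ^ 4 := by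
  have h1 := inv_sqrt_one_add_le hu
  have h2 := inv_sqrt_one_add_le (u := -u) (by rwa [neg_sq])
  rw [← sub_eq_add_neg] at h2
  linear_combination h1 + h2

theorem one_add_le_inv_sqrt_one_sub {v : ℝ} (h0 : 0 ≤ v) (h1 : v < 1) :
    1 + v / 2 ≤ (√(1 - v))⁻¹ := by
  rw [le_inv_comm₀ (by linarith) (Real.sqrt_pos.2 (by linarith))]
  refine Real.sqrt_le_iff.2 ⟨by positivity, ?_⟩
  rw [inv_pow, le_inv_comm₀ (by linarith) (by positivity), ← one_div,
    le_div_iff₀ (by linarith)]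
  nlinarith [pow_nonneg h0 3, sq_nonneg v]

theorem sum_inv_sqrt_lt {ι : Type*} [Fintype ι] (hι : 3 ≤ Fintype.card ι) (y : ι → ℝ) :
    ∑ i, ((√(∑ j, y j ^ 2 + 12 + 2 * y i))⁻¹ + (√(∑ j, y j ^ 2 + 12 - 2 * y i))⁻¹)
      < 2 * Fintype.card ι * (√(∑ j, y j ^ 2 + 11))⁻¹ := by
  set S := ∑ j, y j ^ 2 with hS
  have hS0 : 0 ≤ S := Finset.sum_nonneg fun j _ => sq_nonneg _
  have hyS : ∀ i, y i ^ 2 ≤ S := fun i =>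
    Finset.single_le_sum (f := fun j => y j ^ 2) (fun j _ => sq_nonneg _) (Finset.mem_univ i)
  obtain ⟨t, ht⟩ : ∃ t, t = S + 12 := ⟨_, rfl⟩
  have ht0 : 0 < t := by linarith
  have hst : 0 < (√t)⁻¹ := by positivity
  have hcard : (3 : ℝ) ≤ Fintype.card ι := by exact_mod_cast hι
  have hu : ∀ i, (2 * y i / t) ^ 2 ≤ 4 * S / t ^ 2 := fun i => by
    rw [div_pow]
    gcongr
    linarith [hyS i]
  have hS12 : 4 * S / t ^ 2 ≤ 1 / 12 := by
    rw [div_le_div_iff₀ (by positivity) (by norm_num), ht]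
    nlinarith [sq_nonneg (S - 12)]
  have hterm : ∀ i, (√(S + 12 + 2 * y i))⁻¹ + (√(S + 12 - 2 * y i))⁻¹
      ≤ (√t)⁻¹ * (2 + (3 + 32 * S / t ^ 2) / t ^ 2 * y i ^ 2) := fun i => by
    have e1 : S + 12 + 2 * y i = t * (1 + 2 * y i / t) := by rw [← ht]; field_simp
    have e2 : S + 12 - 2 * y i = t * (1 - 2 * y i / t) := by rw [← ht]; field_simp
    rw [e1, e2, Real.sqrt_mul ht0.le, Real.sqrt_mul ht0.le, mul_inv, mul_inv, ← mul_add]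
    refine mul_le_mul_of_nonneg_left ?_ hst.le
    refine (inv_sqrt_add_inv_sqrt_sub_le ((hu i).trans hS12)).trans ?_
    have h4 : (2 * y i / t) ^ 4 ≤ 4 * S / t ^ 2 * (2 * y i / t) ^ 2 := by
      nlinarith [mul_le_mul_of_nonneg_right (hu i) (sq_nonneg (2 * y i / t))]
    have e3 : (3 + 32 * S / t ^ 2) / t ^ 2 * y i ^ 2
        = 3 / 4 * (2 * y i / t) ^ 2 + 2 * (4 * S / t ^ 2 * (2 * y i / t) ^ 2) := by
      field_simp
      ring
    rw [e3]
    linarith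
  have hrhs : (√t)⁻¹ * (1 + t⁻¹ / 2) ≤ (√(S + 11))⁻¹ := by
    have e1 : S + 11 = t * (1 - t⁻¹) := by field_simp; linarith
    rw [e1, Real.sqrt_mul ht0.le, mul_inv]
    gcongr
    exact one_add_le_inv_sqrt_one_sub (by positivity) (inv_lt_one_of_one_lt₀ (by linarith))
  have hkey : (3 + 32 * S / t ^ 2) / t ^ 2 * S < 3 * t⁻¹ := by
    rw [show (3 + 32 * S / t ^ 2) / t ^ 2 * S = ((3 * t ^ 2 + 32 * S) * S / t ^ 3) * t⁻¹ by
      field_simp]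
    gcongr
    rw [div_lt_iff₀ (by positivity), ht]
    nlinarith [pow_nonneg hS0 3, sq_nonneg S]
  calc _ ≤ ∑ i, (√t)⁻¹ * (2 + (3 + 32 * S / t ^ 2) / t ^ 2 * y i ^ 2) :=
        Finset.sum_le_sum fun i _ => hterm i
    _ = (√t)⁻¹ * (2 * Fintype.card ι + (3 + 32 * S / t ^ 2) / t ^ 2 * S) := by
        rw [← Finset.mul_sum, Finset.sum_add_distrib, ← Finset.mul_sum, ← hS]
        simp [mul_comm]
    _ < (√t)⁻¹ * (2 * Fintype.card ι + Fintype.card ι * t⁻¹) := by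
        have : 3 * t⁻¹ ≤ Fintype.card ι * t⁻¹ := by gcongr
        exact mul_lt_mul_of_pos_left (by linarith) hst
    _ = 2 * Fintype.card ι * ((√t)⁻¹ * (1 + t⁻¹ / 2)) := by ring
    _ ≤ _ := by gcongr

variable {d : ℕ}

/-- The function `(|x|² + 11)^{-1/2}` on `ℤ^d`, superharmonic when `d ≥ 3`. -/
def potential (x : Fin d → ℤ) : ℝ := (√(∑ i, (x i : ℝ) ^ 2 + 11))⁻¹

theorem potential_pos (x : Fin d → ℤ) : 0 < potential x := by
  unfold potential
  positivity

theorem sum_sq_nbr (y : Fin d → ℤ) (p : Fin d × Bool) :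
    ∑ i, (nbr y p i : ℝ) ^ 2 = ∑ i, (y i : ℝ) ^ 2 + 1 + 2 * (if p.2 then 1 else -1) * y p.1 := by
  have h : ∀ i, (nbr y p i : ℝ) ^ 2
      = (y i : ℝ) ^ 2 + if i = p.1 then 1 + 2 * (if p.2 then 1 else -1) * (y p.1 : ℝ) else 0 := by
    intro i
    by_cases hi : i = p.1
    · subst hi
      simp only [nbr, Pi.add_apply, Pi.single_eq_same, if_true]
      split_ifs <;> push_cast <;> ring
    · simp [nbr, hi]
  simp only [h, Finset.sum_add_distrib, Finset.sum_ite_eq', Finset.mem_univ, if_true]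
  ring

theorem sum_potential_nbr_lt (hd : 3 ≤ d) (y : Fin d → ℤ) :
    ∑ p, potential (nbr y p) < 2 * d * potential y := by
  have h := sum_inv_sqrt_lt (ι := Fin d) (by simpa using hd) fun i => (y i : ℝ)
  rw [Fintype.card_fin] at h
  refine lt_of_eq_of_lt ?_ h
  rw [Fintype.sum_prod_type]
  refine Finset.sum_congr rfl fun i _ => ?_
  simp only [Fintype.sum_bool, potential, sum_sq_nbr]
  congr 3 <;> simp <;> ring

/-- Decay of the lattice Green's function in dimension at least three. -/
theorem exists_green_le (hd : 3 ≤ d) :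
    ∃ C : ℝ, 0 < C ∧ ∀ y, g d 0 y ≤ ENNReal.ofReal (C * potential y) := by
  set δ : ℝ := 2 * d * potential (0 : Fin d → ℤ) - ∑ p, potential (nbr (0 : Fin d → ℤ) p) with hδ
  have hδ0 : 0 < δ := sub_pos.2 (sum_potential_nbr_lt hd 0)
  refine ⟨δ⁻¹, by positivity, fun y => ?_⟩
  have h := sum_green_le (cZ d) (A := {0})
    (u := fun y => ENNReal.ofReal (δ⁻¹ * potential y)) (fun y => ?_) y
  · simpa [g] using h
  · rw [tsum_mul_cZ, piW_cZ, ← ENNReal.ofReal_sum_of_nonneg fun p _ =>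
      (mul_pos (inv_pos.2 hδ0) (potential_pos _)).le,
      show (2 * d : ℝ≥0∞) = ENNReal.ofReal (2 * d) by
        rw [ENNReal.ofReal_mul (by norm_num)]; simp,
      ← ENNReal.ofReal_mul (by positivity), ← Finset.mul_sum]
    have hlt := sum_potential_nbr_lt hd y
    by_cases hy : y = 0
    · subst hy
      rw [if_pos (by simp), ← ENNReal.ofReal_one, ← ENNReal.ofReal_add zero_le_one
        (mul_nonneg (inv_pos.2 hδ0).le (Finset.sum_nonneg fun p _ => (potential_pos _).le))]
      refine ENNReal.ofReal_le_ofReal (le_of_eq ?_)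
      field_simp
      rw [hδ]
      ring
    · rw [if_neg (by simpa using hy), zero_add]
      refine ENNReal.ofReal_le_ofReal ?_
      rw [mul_left_comm]
      gcongr

end Superharmonic
section HalfLattice

variable {d : ℕ}

theorem cZ_congr_natAbs {x y x' y' : Fin d → ℤ}
    (h : ∀ i, (x' i - y' i).natAbs = (x i - y i).natAbs) : cZ d x' y' = cZ d x y := by
  simp only [cZ, latAdj, h]

theorem cZ_addRight (a x y : Fin d → ℤ) :
    cZ d (Equiv.addRight a x) (Equiv.addRight a y) = cZ d x y :=
  cZ_congr_natAbs fun i => by simp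

theorem g_add_right (a x y : Fin d → ℤ) : g d (x + a) (y + a) = g d x y :=
  green_perm (cZ d) (Equiv.addRight a) (cZ_addRight a) x y

theorem natAbs_sub_le_one {x y : Fin d → ℤ} (h : latAdj x y) (i : Fin d) :
    (x i - y i).natAbs ≤ 1 := by
  unfold latAdj at h
  rw [← h]
  exact Finset.single_le_sum (f := fun i => (x i - y i).natAbs) (fun _ _ => Nat.zero_le _)
    (Finset.mem_univ i)

theorem latAdj_nbr (y : Fin d → ℤ) (p : Fin d × Bool) : latAdj (nbr y p) y :=
  latAdj_iff_mem_range_nbr.2 ⟨p, rfl⟩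

theorem g_ne_top (hd : 3 ≤ d) (x y : Fin d → ℤ) : g d x y ≠ ∞ := by
  obtain ⟨C, -, hC⟩ := exists_green_le hd
  have h := g_add_right (-x) x y
  rw [add_neg_cancel] at h
  rw [← h]
  exact ne_top_of_le_ne_top ENNReal.ofReal_ne_top (hC _)

variable [NeZero d]

/-- The reflection of `ℤ^d` replacing the first coordinate `t` by `a - t`. -/
def mirror (a : ℤ) : Equiv.Perm (Fin d → ℤ) :=
  Function.Involutive.toPerm (fun y i => if i = 0 then a - y i else y i) fun y => by
    funext i
    by_cases h : i = 0 <;> simp [h]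

theorem mirror_apply (a : ℤ) (y : Fin d → ℤ) (i : Fin d) :
    mirror a y i = if i = 0 then a - y i else y i := rfl

theorem mirror_mirror (a : ℤ) (y : Fin d → ℤ) : mirror a (mirror a y) = y := by
  funext i
  by_cases h : i = 0 <;> simp [mirror_apply, h]

theorem cZ_mirror (a : ℤ) (x y : Fin d → ℤ) : cZ d (mirror a x) (mirror a y) = cZ d x y :=
  cZ_congr_natAbs fun i => by
    by_cases h : i = 0
    · simp only [mirror_apply, h, if_true]
      omega
    · simp [mirror_apply, h]

theorem g_mirror (a : ℤ) (x y : Fin d → ℤ) : g d (mirror a x) (mirror a y) = g d x y :=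
  green_perm (cZ d) (mirror a) (cZ_mirror a) x y

theorem memU_one_iff {y : Fin d → ℤ} : memU 1 y ↔ 0 ≤ y 0 := by
  refine ⟨fun h => h 0 (by simp), fun h i hi => ?_⟩
  have : i = 0 := Fin.ext (by simpa using hi)
  rwa [this]

theorem memU_mirror_iff {y : Fin d → ℤ} : memU 1 (mirror (-1) y) ↔ ¬ memU 1 y := by
  rw [memU_one_iff, memU_one_iff, mirror_apply, if_pos rfl]
  omega

/-- A boundary-crossing edge of `ℤ^d` joins a vertex to its mirror image. -/
theorem eq_mirror_of_latAdj {z y : Fin d → ℤ} (hz : ¬ memU 1 z) (hy : memU 1 y)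
    (h : latAdj z y) : z = mirror (-1) y := by
  rw [memU_one_iff] at hz hy
  have h0 := natAbs_sub_le_one h 0
  unfold latAdj at h
  rw [← Finset.add_sum_erase _ _ (Finset.mem_univ 0)] at h
  have hs : ∑ j ∈ Finset.univ.erase 0, (z j - y j).natAbs = 0 := by omega
  rw [Finset.sum_eq_zero_iff] at hs
  funext i
  by_cases hi : i = 0
  · subst hi
    rw [mirror_apply, if_pos rfl]
    omega
  · have := hs i (by simp [hi])
    rw [mirror_apply, if_neg hi]
    omega

/-- Total conductance of the edges of `ℤ^d` joining `y` to the complement of the half lattice. -/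
def crossing (y : Fin d → ℤ) : ℝ≥0∞ := ∑' z, if memU 1 z then 0 else cZ d z y

/-- For functions symmetric under the mirror map, the edges leaving the half lattice act as
self-loops. -/
theorem tsum_mul_cZ_eq {w : (Fin d → ℤ) → ℝ≥0∞} (hw : ∀ z, w (mirror (-1) z) = w z)
    {y : Fin d → ℤ} (hy : memU 1 y) :
    ∑' z, w z * cZ d z y = ∑' z, w z * cU d 1 z y + crossing y * w y := by
  rw [crossing, ← ENNReal.tsum_mul_right, ← ENNReal.tsum_add]
  refine tsum_congr fun z => ?_
  by_cases hz : memU 1 z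
  · simp [cZ, cU, hz, hy]
  · by_cases h : latAdj z y
    · rw [eq_mirror_of_latAdj hz hy h, hw, ← eq_mirror_of_latAdj hz hy h]
      simp [cU, hz, mul_comm]
    · simp [cU, cZ, h]

theorem piW_cZ_eq {y : Fin d → ℤ} (hy : memU 1 y) :
    piW (cZ d) y = piW (cU d 1) y + crossing y := by
  have := tsum_mul_cZ_eq (w := fun _ => 1) (fun _ => rfl) hy
  rw [piW, piW]
  simpa only [one_mul, mul_one, cZ_comm _ y, cU_comm 1 _ y] using this

theorem crossing_ne_top {y : Fin d → ℤ} (hy : memU 1 y) : crossing y ≠ ∞ := by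
  refine ne_top_of_le_ne_top (piW_cZ_ne_top y) ?_
  rw [piW_cZ_eq hy]
  exact le_add_self

theorem piW_cU_ne_top {y : Fin d → ℤ} (hy : memU 1 y) : piW (cU d 1) y ≠ ∞ := by
  refine ne_top_of_le_ne_top (piW_cZ_ne_top y) ?_
  rw [piW_cZ_eq hy]
  exact le_self_add

theorem piW_cU_ne_zero {y : Fin d → ℤ} (hy : memU 1 y) : piW (cU d 1) y ≠ 0 := by
  rw [piW, Ne, ENNReal.tsum_eq_zero, not_forall]
  refine ⟨nbr y (0, true), ?_⟩
  have h : memU 1 (nbr y (0, true)) := by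
    rw [memU_one_iff] at hy ⊢
    simp only [nbr, Pi.add_apply, Pi.single_eq_same, if_true]
    omega
  rw [cU, if_pos ⟨hy, h, latAdj_comm.1 (latAdj_nbr y _)⟩]
  exact one_ne_zero

theorem Gm_one_le (hd : 3 ≤ d) {x : Fin d → ℤ} (hx : memU 1 x) (y : Fin d → ℤ) :
    Gm d 1 x y ≤ g d x y + g d x (mirror (-1) y) := by
  have hxr : ∀ y : Fin d → ℤ, memU 1 y → x ≠ mirror (-1) y := fun y hy h => by
    rw [h, memU_mirror_iff] at hx
    exact hx hy
  have h := sum_green_le (cU d 1) (A := {x})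
    (u := fun y => g d x y + g d x (mirror (-1) y)) (fun y => ?_) y
  · simpa [Gm] using h
  · simp only [Finset.mem_singleton]
    by_cases hy : memU 1 y
    · have hsymm : ∀ z : Fin d → ℤ, g d x (mirror (-1) z) + g d x (mirror (-1) (mirror (-1) z))
          = g d x z + g d x (mirror (-1) z) := fun z => by rw [mirror_mirror, add_comm]
      have h1 := piW_mul_green (cZ d) x (piW_cZ_ne_zero y) (piW_cZ_ne_top y)
      have h2 := piW_mul_green (cZ d) x (piW_cZ_ne_zero (mirror (-1) y)) (piW_cZ_ne_top _)
      rw [if_neg (hxr y hy), zero_add, piW_perm (cZ d) _ (cZ_mirror (-1)),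
        ← (mirror (-1)).tsum_eq] at h2
      simp only [cZ_mirror] at h2
      have h3 : piW (cZ d) y * (g d x y + g d x (mirror (-1) y)) = (if x = y then 1 else 0) +
          ∑' z, (g d x z + g d x (mirror (-1) z)) * cZ d z y := by
        simp only [add_mul]
        rw [mul_add, ENNReal.tsum_add, ← add_assoc]
        exact congrArg₂ _ h1 h2
      rw [tsum_mul_cZ_eq (w := fun z => g d x z + g d x (mirror (-1) z)) hsymm hy,
        piW_cZ_eq hy, add_mul, ← add_assoc] at h3
      have hfin : crossing y * (g d x y + g d x (mirror (-1) y)) ≠ ∞ :=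
        ENNReal.mul_ne_top (crossing_ne_top hy)
          (ENNReal.add_ne_top.2 ⟨g_ne_top hd _ _, g_ne_top hd _ _⟩)
      rw [(ENNReal.add_left_inj hfin).1 h3]
      simp only [eq_comm (a := y)]
      exact le_rfl
    · have hne : y ≠ x := fun h => hy (h ▸ hx)
      simp [hne, cU, hy]

/-- The mirror-symmetric map of `ℤ^d` onto the half lattice. -/
def fold (y : Fin d → ℤ) : Fin d → ℤ := if memU 1 y then y else mirror (-1) y

theorem fold_mirror (y : Fin d → ℤ) : fold (mirror (-1) y) = fold y := by
  unfold fold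
  by_cases hy : memU 1 y <;> simp [memU_mirror_iff, hy, mirror_mirror]

theorem le_Gm_one {x : Fin d → ℤ} (hx : memU 1 x) {y : Fin d → ℤ} (hy : memU 1 y) :
    g d x y + g d x (mirror (-1) y) ≤ Gm d 1 x y := by
  have hxr : ∀ y : Fin d → ℤ, memU 1 y → y ≠ mirror (-1) x := fun y hy h => by
    rw [h, memU_mirror_iff] at hy
    exact hy hx
  have hmain : ∀ y : Fin d → ℤ, memU 1 y → (if y ∈ ({x, mirror (-1) x} : Finset _) then 1 else 0) +
      ∑' z, Gm d 1 x (fold z) * cZ d z y ≤ piW (cZ d) y * Gm d 1 x (fold y) := fun y hy => by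
    have hA : y ∈ ({x, mirror (-1) x} : Finset _) ↔ x = y := by
      simp [hxr y hy, eq_comm]
    rw [tsum_mul_cZ_eq (w := fun z => Gm d 1 x (fold z)) (fun z => by rw [fold_mirror]) hy,
      piW_cZ_eq hy, add_mul, ← add_assoc]
    refine add_le_add (le_of_eq ?_) le_rfl
    have hfy : fold y = y := if_pos hy
    have h1 := piW_mul_green (cU d 1) x (piW_cU_ne_zero hy) (piW_cU_ne_top hy)
    rw [hfy, Gm, h1]
    simp only [hA]
    congr 1
    refine tsum_congr fun z => ?_
    by_cases hz : memU 1 z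
    · simp [fold, hz]
    · simp [cU, hz]
  have h := sum_green_le (cZ d) (A := {x, mirror (-1) x})
    (u := fun y => Gm d 1 x (fold y)) (fun y => ?_) y
  · rw [Finset.sum_pair (hxr x hx)] at h
    have hfy : fold y = y := if_pos hy
    rw [hfy] at h
    have hr := g_mirror (-1) x (mirror (-1) y)
    rw [mirror_mirror] at hr
    rw [← hr]
    exact h
  · by_cases hy : memU 1 y
    · exact hmain y hy
    · have h2 := hmain (mirror (-1) y) (memU_mirror_iff.2 hy)
      rw [← (mirror (-1)).tsum_eq, piW_perm (cZ d) _ (cZ_mirror (-1))] at h2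
      simp only [cZ_mirror, fold_mirror] at h2
      have hA : mirror (-1) y ∈ ({x, mirror (-1) x} : Finset _) ↔
          y ∈ ({x, mirror (-1) x} : Finset _) := by
        have h3 : mirror (-1) y = x ↔ y = mirror (-1) x :=
          ⟨fun h => by rw [← h, mirror_mirror], fun h => by rw [h, mirror_mirror]⟩
        simp only [Finset.mem_insert, Finset.mem_singleton, h3, (mirror (-1)).injective.eq_iff]
        exact or_comm
      simpa only [hA] using h2

/-- The method of images for the Green's function of the half lattice. -/
theorem Gm_one_eq (hd : 3 ≤ d) {x y : Fin d → ℤ} (hx : memU 1 x) (hy : memU 1 y) :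
    Gm d 1 x y = g d x y + g d x (mirror (-1) y) :=
  le_antisymm (Gm_one_le hd hx y) (le_Gm_one hx hy)

theorem Gm_one_self (hd : 3 ≤ d) {x : Fin d → ℤ} (hx : memU 1 x) :
    Gm d 1 x x = g d 0 0 + g d 0 (Pi.single 0 (2 * x 0 + 1)) := by
  rw [Gm_one_eq hd hx hx]
  have h1 := g_add_right (-x) x x
  have h2 := g_add_right (-x) x (mirror (-1) x)
  have h3 := g_mirror 0 0 (mirror (-1) x + -x)
  have e0 : mirror 0 (0 : Fin d → ℤ) = 0 := by
    funext i
    simp [mirror_apply]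
  have e1 : mirror 0 (mirror (-1) x + -x) = Pi.single 0 (2 * x 0 + 1) := by
    funext i
    by_cases hi : i = 0
    · subst hi
      simp only [mirror_apply, if_true, Pi.add_apply, Pi.neg_apply, Pi.single_eq_same]
      ring
    · simp [mirror_apply, hi]
  rw [add_neg_cancel] at h1 h2
  rw [e0, e1] at h3
  rw [← h1, ← h2, h3]

/-- Heat-kernel monotonicity along the first coordinate, in steps of two. -/
theorem stepN_cZ_le (n : ℕ) {y : Fin d → ℤ} (hy : 1 ≤ y 0) :
    stepN (cZ d) n 0 y ≤ stepN (cZ d) n 0 (y + Pi.single 0 (-2)) := by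
  induction n generalizing y with
  | zero =>
    have : (0 : Fin d → ℤ) ≠ y := fun h => by simp [← h] at hy
    simp [stepN, this]
  | succ n ih =>
    rcases hy.eq_or_lt with h1 | h2
    · have e0 : mirror 0 (0 : Fin d → ℤ) = 0 := by
        funext i
        simp [mirror_apply]
      have e1 : y + Pi.single 0 (-2) = mirror 0 y := by
        funext i
        by_cases hi : i = 0
        · subst hi
          simp [mirror_apply, ← h1]
        · simp [mirror_apply, hi]
      rw [e1]
      conv_rhs => rw [← e0]
      rw [stepN_perm (cZ d) (mirror 0) (cZ_mirror 0)]
    · simp only [stepN]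
      conv_rhs => rw [← (Equiv.addRight (Pi.single 0 (-2) : Fin d → ℤ)).tsum_eq]
      refine ENNReal.tsum_le_tsum fun z => ?_
      by_cases hz : latAdj z y
      · have hc := cZ_addRight (Pi.single 0 (-2)) z y
        have hs : step (cZ d) (Equiv.addRight (Pi.single 0 (-2)) z) (y + Pi.single 0 (-2))
            = step (cZ d) z y := by
          rw [step, step, piW_cZ, piW_cZ]
          exact congrArg₂ _ hc rfl
        rw [hs]
        gcongr
        refine ih ?_
        have := natAbs_sub_le_one hz 0
        omega
      · simp [step, cZ, hz]

theorem g_single_le (k : ℕ) :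
    g d 0 (Pi.single 0 (2 * k + 1)) ≤ g d 0 (Pi.single 0 1) := by
  induction k with
  | zero => simp
  | succ k ih =>
    refine le_trans ?_ ih
    have e : (Pi.single 0 (2 * k + 1) : Fin d → ℤ)
        = Pi.single 0 (2 * ((k + 1 : ℕ) : ℤ) + 1) + Pi.single 0 (-2) := by
      rw [← Pi.single_add]
      congr 1
      push_cast
      ring
    rw [e, g, green, green, piW_cZ, piW_cZ]
    gcongr with n
    refine stepN_cZ_le n ?_
    rw [Pi.single_eq_same]
    omega

theorem g_single_one_pos : 0 < g d 0 (Pi.single 0 1) := by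
  have h0 : g d 0 0 ≠ 0 := fun h => by
    have h1 := piW_mul_green (cZ d) 0 (piW_cZ_ne_zero 0) (piW_cZ_ne_top 0)
    rw [← g, h, mul_zero] at h1
    simpa using (add_eq_zero.1 h1.symm).1
  have hadj : latAdj (0 : Fin d → ℤ) (Pi.single 0 1) := by
    have := latAdj_nbr (0 : Fin d → ℤ) (0, true)
    rw [latAdj_comm]
    simpa [nbr] using this
  refine pos_iff_ne_zero.2 fun h => h0 ?_
  have h1 := piW_mul_green (cZ d) 0 (piW_cZ_ne_zero (Pi.single 0 1)) (piW_cZ_ne_top _)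
  rw [← g, h, mul_zero] at h1
  have h2 := ENNReal.tsum_eq_zero.1 (add_eq_zero.1 h1.symm).2 0
  simpa [cZ, hadj] using h2

theorem tendsto_g_single (hd : 3 ≤ d) :
    Tendsto (fun k : ℕ => g d 0 (Pi.single 0 (2 * (k : ℤ) + 1))) atTop (nhds 0) := by
  obtain ⟨C, hC0, hC⟩ := exists_green_le hd
  refine tendsto_of_tendsto_of_tendsto_of_le_of_le tendsto_const_nhds ?_ (fun _ => zero_le)
    fun k => hC _
  have hp : ∀ k : ℕ, potential (Pi.single 0 (2 * (k : ℤ) + 1) : Fin d → ℤ)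
      ≤ 1 / ((k : ℝ) + 1) := fun k => by
    rw [potential, one_div]
    gcongr
    refine Real.le_sqrt_of_sq_le ?_
    rw [Finset.sum_eq_single 0 (fun i _ hi => by simp [hi]) (by simp), Pi.single_eq_same]
    push_cast
    nlinarith [(k.cast_nonneg : (0 : ℝ) ≤ k)]
  rw [← ENNReal.ofReal_zero]
  refine ENNReal.tendsto_ofReal ?_
  rw [← mul_zero C]
  exact (squeeze_zero (fun k => (potential_pos _).le) hp
    tendsto_one_div_add_atTop_nhds_zero_nat).const_mul C

end HalfLattice

/-- For `d ≥ 3`: `inf_{x ∈ H} G_H(x,x) = g(0,0)`, `sup_{x ∈ H} G_H(x,x) = G_H(0,0)`,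
and `g(0,0) < G_H(0,0)` strictly, where `H = U_1` is the half lattice. -/
theorem green_half_lattice_inf_sup (d : ℕ) (hd : 3 ≤ d) :
    (⨅ (x : Fin d → ℤ) (_ : memU 1 x), Gm d 1 x x) = g d 0 0 ∧
    (⨆ (x : Fin d → ℤ) (_ : memU 1 x), Gm d 1 x x) = Gm d 1 0 0 ∧
    g d 0 0 < Gm d 1 0 0 := by
  have : NeZero d := ⟨by omega⟩
  have h0 : memU 1 (0 : Fin d → ℤ) := memU_one_iff.2 le_rfl
  have hG0 : Gm d 1 0 0 = g d 0 0 + g d 0 (Pi.single 0 1) := by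
    simpa using Gm_one_self hd h0
  refine ⟨le_antisymm ?_ ?_, le_antisymm ?_ ?_, ?_⟩
  · have hlim := (tendsto_const_nhds (x := g d 0 0)).add (tendsto_g_single hd)
    rw [add_zero] at hlim
    refine ge_of_tendsto' hlim fun k => ?_
    have hk : memU 1 (Pi.single 0 (k : ℤ) : Fin d → ℤ) := memU_one_iff.2 (by simp)
    refine (iInf₂_le _ hk).trans (le_of_eq ?_)
    rw [Gm_one_self hd hk, Pi.single_eq_same]
  · refine le_iInf₂ fun x hx => ?_
    rw [Gm_one_self hd hx]
    exact le_self_add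
  · refine iSup₂_le fun x hx => ?_
    rw [Gm_one_self hd hx, hG0]
    gcongr
    obtain ⟨k, hk⟩ := Int.eq_ofNat_of_zero_le (memU_one_iff.1 hx)
    rw [hk]
    exact g_single_le k
  · exact le_iSup₂ (f := fun (x : Fin d → ℤ) (_ : memU 1 x) => Gm d 1 x x) 0 h0
  · rw [hG0]
    exact ENNReal.lt_add_right (g_ne_top hd 0 0) g_single_one_pos.ne'

end
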